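/- Let t₁, t₂, t₃ be rooted trees with |t₁| + |t₂| = |t₃|. Then |SG(t₁)|·|SG(t₂)|·m(t₁,t₂;t₃) = n(t₁,t₂;t₃)·|SG(t₃)|. -/

import Mathlib

attribute [local instance] Classical.propDecidable

inductive PlanarTree : Type where
  | node : List PlanarTree → PlanarTree

namespace PlanarTree

/-- Isomorphism of (planar representatives of) rooted trees: the lists of
principal branches match up, pairwise isomorphically, after a permutation. -/
inductive Iso : PlanarTree → PlanarTree → Prop where
  | node {l m l' : List PlanarTree} :
      List.Perm l m → List.Forall₂ Iso m l' → Iso (node l) (node l')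

/-- Number of vertices. -/
def size : PlanarTree → ℕ
  | node l => 1 + (l.attach.map fun c => size c.1).sum
decreasing_by simp only [PlanarTree.node.sizeOf_spec]; exact Nat.lt_of_lt_of_le (List.sizeOf_lt_of_mem c.2) (Nat.le_add_left _ _)

mutual
  /-- All trees obtained by attaching the root of `s` by a new edge to some vertex. -/
  def graftList (s : PlanarTree) : PlanarTree → List PlanarTree
    | node l => node (s :: l) :: (graftAux s l).map node
  def graftAux (s : PlanarTree) : List PlanarTree → List (List PlanarTree)
    | [] => []
    | a :: l => ((graftList s a).map (· :: l)) ++ (graftAux s l).map (a :: ·)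
end

/-- All trees obtained by adding a new edge and terminal vertex at some vertex. -/
def growList (t : PlanarTree) : List PlanarTree := graftList (node []) t

mutual
  /-- All trees obtained by deleting one (non-root) terminal vertex. -/
  def pruneList : PlanarTree → List PlanarTree
    | node l => (pruneAux l).map node
  def pruneAux : List PlanarTree → List (List PlanarTree)
    | [] => []
    | a :: l =>
        (match a with | node [] => [l] | _ => []) ++
        ((pruneList a).map (· :: l)) ++ (pruneAux l).map (a :: ·)
end

mutual
  /-- All pairs (cut-off subtree, remaining tree) obtained by cutting one edge. -/
  def cutPairs : PlanarTree → List (PlanarTree × PlanarTree)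
    | node l => (cutAux l).map fun x => (x.1, node x.2)
  def cutAux : List PlanarTree → List (PlanarTree × List PlanarTree)
    | [] => []
    | a :: l =>
        (a, l) :: (((cutPairs a).map fun x => (x.1, x.2 :: l)) ++
          (cutAux l).map fun x => (x.1, a :: x.2))
end

/-- The order of the symmetry group `SG(t)`: the product over all vertices `v`
of the number of permutations of the branches at `v` exchanging isomorphic branches. -/
noncomputable def sg : PlanarTree → ℕ
  | node l =>
      (l.attach.map fun c => sg c.1).prod *
        Nat.card {σ : Equiv.Perm (Fin l.length) // ∀ i, Iso (l.get (σ i)) (l.get i)}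
decreasing_by simp only [PlanarTree.node.sizeOf_spec]; exact Nat.lt_of_lt_of_le (List.sizeOf_lt_of_mem c.2) (Nat.le_add_left _ _)

/-- Vertices of a planar tree, encoded as paths of child-indices from the root. -/
inductive IsVertex : PlanarTree → List ℕ → Prop where
  | root (t : PlanarTree) : IsVertex t []
  | child {l : List PlanarTree} {i : ℕ} {c : PlanarTree} {p : List ℕ} :
      l[i]? = some c → IsVertex c p → IsVertex (node l) (i :: p)

def Vertex (t : PlanarTree) : Type := {p : List ℕ // IsVertex t p}

/-- `v` lies strictly below `w` in the tree order (i.e. `w` is a proper ancestor of `v`). -/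
def StrictBelow {t : PlanarTree} (v w : Vertex t) : Prop := w.1 <+: v.1 ∧ w.1 ≠ v.1

/-- A labelling of `t`. -/
def Labelling (t : PlanarTree) : Type :=
  {f : Vertex t ≃ Fin t.size // ∀ v w, StrictBelow v w → f w < f v}

/-- Equivalence of labellings: they differ by an automorphism of the rooted tree. -/
def labelEquiv {t : PlanarTree} (f g : Labelling t) : Prop :=
  ∃ φ : Equiv.Perm (Vertex t),
    (∀ v w, StrictBelow (φ v) (φ w) ↔ StrictBelow v w) ∧ ∀ v, f.1 (φ v) = g.1 v

end PlanarTree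

/-- Rooted trees: isomorphism classes of planar rooted trees. -/
instance planarSetoid : Setoid PlanarTree := Relation.EqvGen.setoid PlanarTree.Iso

def RTree : Type := Quotient planarSetoid

namespace RTree

def mk (p : PlanarTree) : RTree := ⟦p⟧

/-- A chosen planar representative. -/
noncomputable def rep (T : RTree) : PlanarTree := Quotient.out T

noncomputable def size (T : RTree) : ℕ := T.rep.size

/-- The order of the symmetry (automorphism) group of `T`. -/
noncomputable def sg (T : RTree) : ℕ := T.rep.sg

/-- The one-vertex tree. -/
def bullet : RTree := mk (PlanarTree.node [])

/-- `Covers T T'` means `T ⊲ T'`: `T` is obtained from `T'` by deleting one terminal vertex. -/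
noncomputable def Covers (T T' : RTree) : Prop :=
  ∃ p ∈ T'.rep.pruneList, mk p = T

/-- `n(T;T')`: the number of vertices of `T` to which a new edge can be added to obtain `T'`. -/
noncomputable def nCov (T T' : RTree) : ℕ :=
  T.rep.growList.countP fun p => decide (mk p = T')

/-- `m(T;T')`: the number of (terminal) edges of `T'` which when removed leave `T`. -/
noncomputable def mCov (T T' : RTree) : ℕ :=
  T'.rep.pruneList.countP fun p => decide (mk p = T)

/-- `n(T₁,T₂;T₃)`: the number of vertices of `T₂` such that attaching the root of `T₁`
there by a new edge yields `T₃`. -/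
noncomputable def nTri (T₁ T₂ T₃ : RTree) : ℕ :=
  (PlanarTree.graftList T₁.rep T₂.rep).countP fun p => decide (mk p = T₃)

/-- `m(T₁,T₂;T₃)`: the number of edges of `T₃` whose removal cuts off a subtree
isomorphic to `T₁` leaving `T₂` (the piece containing the root). -/
noncomputable def mTri (T₁ T₂ T₃ : RTree) : ℕ :=
  T₃.rep.cutPairs.countP fun x => decide (mk x.1 = T₁ ∧ mk x.2 = T₂)

end RTree

section Ops

variable (k : Type*) [Semiring k]

/-- The element `𝔑(T) = Σ_{T ⊲ T'} n(T;T')·T'` of `k{T}`. -/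
noncomputable def growF (T : RTree) : RTree →₀ k :=
  (T.rep.growList.map fun p => Finsupp.single (RTree.mk p) (1 : k)).sum

/-- The element `𝔓(T) = Σ_{T' ⊲ T} m(T';T)·T'` of `k{T}`. -/
noncomputable def pruneF (T : RTree) : RTree →₀ k :=
  (T.rep.pruneList.map fun p => Finsupp.single (RTree.mk p) (1 : k)).sum

/-- The growth operator `𝔑` on `k{T}`. -/
noncomputable def Grow : Module.End k (RTree →₀ k) :=
  Finsupp.linearCombination k (growF k)

/-- The pruning operator `𝔓` on `k{T}`. -/
noncomputable def Prune : Module.End k (RTree →₀ k) :=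
  Finsupp.linearCombination k (pruneF k)

/-- The operator `𝔇` on `k{T}`, `𝔇(t) = |t|·t`. -/
noncomputable def Diag : Module.End k (RTree →₀ k) :=
  Finsupp.linearCombination k fun T => (T.size : k) • Finsupp.single T 1

/-- The inner product on `k{T}` determined by `(t,t') = |SG(t)|·δ_{t,t'}`. -/
noncomputable def innerT (x y : RTree →₀ k) : k :=
  x.sum fun T c => c * y T * (T.sg : k)

/-- Generalized multiplicity `n(T;T')`: coefficient of `T'` in `𝔑^{|T'|-|T|}(T)`. -/
noncomputable def nGen (T T' : RTree) : k :=
  ((Grow k ^ (T'.size - T.size)) (Finsupp.single T 1)) T'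

/-- Generalized multiplicity `m(T;T')`: coefficient of `T` in `𝔓^{|T'|-|T|}(T')`. -/
noncomputable def mGen (T T' : RTree) : k :=
  ((Prune k ^ (T'.size - T.size)) (Finsupp.single T' 1)) T

end Ops

section Kreimer

variable (k : Type*) [CommSemiring k]

/-- Kreimer's Hopf algebra `H_K`, as a commutative algebra: the free polynomial
algebra on rooted trees. -/
abbrev HK := MvPolynomial RTree k

/-- The inclusion `k{T} → H_K` of the linear span of the variables. -/
noncomputable def toHK : (RTree →₀ k) →ₗ[k] HK k :=
  Finsupp.linearCombination k fun T => MvPolynomial.X T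

/-- The growth derivation `N` on `H_K`, with `N(t) = 𝔑(t)` for rooted trees `t`. -/
noncomputable def ND : Derivation k (HK k) (HK k) :=
  MvPolynomial.mkDerivation k fun T => toHK k (growF k T)

/-- The pruning derivation `P` on `H_K`, with `P(t) = 𝔓(t)` for `|t| ≥ 2`, `P(•) = 1`. -/
noncomputable def PD : Derivation k (HK k) (HK k) :=
  MvPolynomial.mkDerivation k fun T =>
    if T = RTree.bullet then 1 else toHK k (pruneF k T)

/-- The grading derivation `D` on `H_K`, multiplying each homogeneous element of
degree `n` by `n`; it is the derivation with `D(t) = |t|·t` for rooted trees `t`. -/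
noncomputable def DD : Derivation k (HK k) (HK k) :=
  MvPolynomial.mkDerivation k fun T => (T.size : k) • MvPolynomial.X T

/-- The map `B₊ : H_K → k{T}` sending a forest to the tree obtained by attaching
all its roots to a new root vertex. -/
noncomputable def forestTree (d : RTree →₀ ℕ) : RTree :=
  RTree.mk (PlanarTree.node
    (d.support.toList.flatMap fun T => List.replicate (d T) T.rep))

noncomputable def Bplus (p : HK k) : RTree →₀ k :=
  ∑ d ∈ p.support, Finsupp.single (forestTree d) (MvPolynomial.coeff d p)

/-- The inner product on `H_K`. -/
noncomputable def innerHK (u v : HK k) : k := innerT k (Bplus k u) (Bplus k v)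

/-- The degree-`n` homogeneous component of `H_K`. -/
noncomputable abbrev HKcomp (n : ℕ) : Submodule k (HK k) :=
  MvPolynomial.weightedHomogeneousSubmodule k (fun T : RTree => T.size) n

/-- `T_i`: the number of rooted trees with `i+1` vertices. -/
noncomputable def Tcard (i : ℕ) : ℕ := Nat.card {T : RTree // T.size = i + 1}

end Kreimer

namespace PlanarTree

theorem induction_on_branches {P : PlanarTree → Prop}
    (node : ∀ l, (∀ a ∈ l, P a) → P (node l)) : ∀ t, P t
  | .node l => node l fun a _ => induction_on_branches node a
decreasing_by
  simp only [PlanarTree.node.sizeOf_spec]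
  exact Nat.lt_of_lt_of_le (List.sizeOf_lt_of_mem ‹_›) (Nat.le_add_left _ _)

theorem rel_coe_iff {α β : Type*} {r : α → β → Prop} {l : List α} {l' : List β} :
    Multiset.Rel r (l : Multiset α) (l' : Multiset β) ↔
      ∃ m, List.Perm l m ∧ List.Forall₂ r m l' := by
  constructor
  · intro h
    generalize hs : (l : Multiset α) = s at h
    generalize ht : (l' : Multiset β) = t at h
    induction h generalizing l l' with
    | zero =>
      obtain rfl := Multiset.coe_eq_zero l |>.1 hs
      obtain rfl := Multiset.coe_eq_zero l' |>.1 ht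
      exact ⟨[], .nil, .nil⟩
    | @cons a b as bs hab h ih =>
      induction as using Quotient.inductionOn with | _ as
      induction bs using Quotient.inductionOn with | _ bs
      obtain ⟨m, hm, hf⟩ := ih (l := as) (l' := bs) rfl rfl
      have h1 : List.Perm l (a :: as) := Multiset.coe_eq_coe.1 hs
      have h2 : List.Perm l' (b :: bs) := Multiset.coe_eq_coe.1 ht
      have h3 : Relation.Comp (List.Forall₂ r) List.Perm (a :: m) l' :=
        ⟨b :: bs, .cons hab hf, h2.symm⟩
      rw [List.forall₂_comp_perm_eq_perm_comp_forall₂] at h3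
      obtain ⟨m', hm', hf'⟩ := h3
      exact ⟨m', h1.trans ((hm.cons a).trans hm'), hf'⟩
  · rintro ⟨m, hm, hf⟩
    rw [Multiset.coe_eq_coe.2 hm]
    clear hm
    induction hf with
    | nil => exact .zero
    | cons hab _ ih => exact .cons hab ih

theorem iso_node_iff {l l' : List PlanarTree} :
    Iso (node l) (node l') ↔ Multiset.Rel Iso (l : Multiset PlanarTree) l' := by
  rw [rel_coe_iff]
  constructor
  · rintro ⟨h, h'⟩
    exact ⟨_, h, h'⟩
  · rintro ⟨m, h, h'⟩
    exact .node h h'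

theorem Iso.refl (t : PlanarTree) : Iso t t := by
  induction t using induction_on_branches with
  | node l ih => exact iso_node_iff.2 (Multiset.rel_refl_of_refl_on ih)

theorem Iso.symm {s t : PlanarTree} (h : Iso s t) : Iso t s := by
  induction s using induction_on_branches generalizing t with
  | node l ih =>
    obtain ⟨l'⟩ := t
    rw [iso_node_iff] at h ⊢
    exact Multiset.rel_flip.1 (h.mono fun a ha b _ hab => ih a ha hab)

theorem rel_trans_of_mem {α : Type*} {r : α → α → Prop} {s t u : Multiset α}
    (h : Multiset.Rel r s t) (h' : Multiset.Rel r t u)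
    (H : ∀ a ∈ s, ∀ b c, r a b → r b c → r a c) : Multiset.Rel r s u := by
  induction h generalizing u with
  | zero => exact h'
  | cons hab _ ih =>
    obtain ⟨c, cs, hbc, hcs, rfl⟩ := Multiset.rel_cons_left.1 h'
    exact .cons (H _ (Multiset.mem_cons_self _ _) _ _ hab hbc)
      (ih hcs fun a ha => H a (Multiset.mem_cons_of_mem ha))

theorem Iso.trans {s t u : PlanarTree} (h : Iso s t) (h' : Iso t u) : Iso s u := by
  induction s using induction_on_branches generalizing t u with
  | node l ih =>
    obtain ⟨l'⟩ := t
    obtain ⟨l''⟩ := u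
    rw [iso_node_iff] at h h' ⊢
    exact rel_trans_of_mem h h' fun a ha b c hab hbc => ih a ha hab hbc

theorem mk_eq_mk_iff {s t : PlanarTree} : RTree.mk s = RTree.mk t ↔ Iso s t := by
  have he : Equivalence Iso := ⟨Iso.refl, Iso.symm, Iso.trans⟩
  exact Quotient.eq.trans he.eqvGen_iff

/-- The multiset of isomorphism classes of the trees in a list. -/
def classes (l : List PlanarTree) : Multiset RTree := (l : Multiset PlanarTree).map RTree.mk

@[simp] theorem classes_cons (a : PlanarTree) (l : List PlanarTree) :
    classes (a :: l) = RTree.mk a ::ₘ classes l := rfl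

theorem mk_mem_classes {a : PlanarTree} {l : List PlanarTree} (h : a ∈ l) :
    RTree.mk a ∈ classes l := Multiset.mem_map_of_mem _ (Multiset.mem_coe.2 h)

theorem mk_node_eq_iff {l l' : List PlanarTree} :
    RTree.mk (node l) = RTree.mk (node l') ↔ classes l = classes l' := by
  rw [mk_eq_mk_iff, iso_node_iff, classes, classes, ← Multiset.rel_eq, Multiset.rel_map]
  simp only [mk_eq_mk_iff]

theorem card_branch_perms (l : List PlanarTree) :
    Nat.card {σ : Equiv.Perm (Fin l.length) // ∀ i, Iso (l.get (σ i)) (l.get i)} =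
      ∏ T ∈ (classes l).toFinset, ((classes l).count T).factorial := by
  have h := DomMulAct.stabilizer_card' fun i : Fin l.length => RTree.mk (l.get i)
  have hc : classes l = (Finset.univ : Finset (Fin l.length)).val.map
      fun i => RTree.mk (l.get i) := by
    rw [Fin.univ_val_map, classes, Multiset.map_coe]
    congr 1
    apply List.ext_get <;> simp
  simp only [← mk_eq_mk_iff]
  rw [← Nat.card_eq_fintype_card] at h
  refine (Nat.card_congr (Equiv.subtypeEquivRight fun σ => by simp [funext_iff])).trans
    (h.trans ?_)
  rw [hc]
  refine Finset.prod_congr rfl fun T _ => ?_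
  rw [Multiset.count_map, Fintype.card_subtype]
  congr 1
  simp only [eq_comm (a := T)]
  rfl

theorem sg_node (l : List PlanarTree) :
    sg (node l) = (l.map sg).prod *
      ∏ T ∈ (classes l).toFinset, ((classes l).count T).factorial := by
  rw [sg, card_branch_perms]
  congr 2
  exact List.attach_map_val (f := sg)

theorem Iso.sg_eq {s t : PlanarTree} (h : Iso s t) : s.sg = t.sg := by
  induction s using induction_on_branches generalizing t with
  | node l ih =>
    obtain ⟨l'⟩ := t
    have hc := mk_node_eq_iff.1 (mk_eq_mk_iff.2 h)
    rw [iso_node_iff] at h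
    have hm : (l : Multiset PlanarTree).map sg = (l' : Multiset PlanarTree).map sg := by
      rw [← Multiset.rel_eq, Multiset.rel_map]
      exact h.mono fun a ha b _ hab => ih a ha hab
    have hp := congrArg Multiset.prod hm
    simp only [Multiset.map_coe, Multiset.prod_coe] at hp
    rw [sg_node, sg_node, hc, hp]

end PlanarTree

namespace RTree

open PlanarTree

theorem mk_rep (T : RTree) : mk T.rep = T := Quotient.out_eq T

theorem sg_mk (t : PlanarTree) : (mk t).sg = t.sg :=
  (mk_eq_mk_iff.1 (mk_rep (mk t))).sg_eq

/-- The order of the symmetry group of the tree whose branches are given by a multiset. -/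
noncomputable def branchSg (M : Multiset RTree) : ℕ :=
  (M.map sg).prod * ∏ T ∈ M.toFinset, (M.count T).factorial

theorem branchSg_cons (T : RTree) (M : Multiset RTree) :
    branchSg (T ::ₘ M) = T.sg * (M.count T + 1) * branchSg M := by
  have h1 : ∏ X ∈ M.toFinset, (M.count X).factorial =
      ∏ X ∈ insert T M.toFinset, (M.count X).factorial := by
    refine Finset.prod_subset (Finset.subset_insert _ _) fun X _ hX => ?_
    rw [Multiset.mem_toFinset] at hX
    simp [Multiset.count_eq_zero_of_notMem hX]
  have h2 : ∏ X ∈ insert T M.toFinset, ((T ::ₘ M).count X).factorial =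
      (M.count T + 1) * ∏ X ∈ insert T M.toFinset, (M.count X).factorial := by
    rw [← Finset.mul_prod_erase _ _ (Finset.mem_insert_self T M.toFinset),
      ← Finset.mul_prod_erase (insert T M.toFinset) (fun X => (M.count X).factorial)
        (Finset.mem_insert_self T M.toFinset), Multiset.count_cons_self, Nat.factorial_succ,
      mul_assoc]
    congr 2
    refine Finset.prod_congr rfl fun X hX => ?_
    rw [Multiset.count_cons_of_ne (Finset.ne_of_mem_erase hX)]
  rw [branchSg, branchSg, Multiset.toFinset_cons, h2, ← h1, Multiset.map_cons, Multiset.prod_cons]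
  ring

theorem branchSg_eq {T : RTree} {M : Multiset RTree} (h : T ∈ M) :
    branchSg M = T.sg * M.count T * branchSg (M.erase T) := by
  conv_lhs => rw [← Multiset.cons_erase h, branchSg_cons, Multiset.count_erase_self,
    Nat.sub_add_cancel (Multiset.count_pos.2 h)]

theorem sg_node_eq_branchSg (l : List PlanarTree) : (node l).sg = branchSg (classes l) := by
  rw [sg_node, branchSg, classes, Multiset.map_map]
  simp only [Function.comp_def, sg_mk, Multiset.map_coe, Multiset.prod_coe]

end RTree

namespace PlanarTree

open RTree (branchSg branchSg_cons)

/-- The number of entries of a list satisfying a predicate. -/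
noncomputable def countWhere {α : Type*} (p : α → Prop) (w : List α) : ℕ :=
  w.countP fun x => decide (p x)

section countWhere

variable {α β : Type*} (p : α → Prop)

@[simp] theorem countWhere_nil : countWhere p [] = 0 := rfl

theorem countWhere_cons (x : α) (w : List α) [Decidable (p x)] :
    countWhere p (x :: w) = countWhere p w + if p x then 1 else 0 := by
  simp only [countWhere, List.countP_cons, decide_eq_true_eq]

theorem countWhere_append (w w' : List α) :
    countWhere p (w ++ w') = countWhere p w + countWhere p w' := by
  simp [countWhere]

theorem countWhere_map (f : β → α) (w : List β) :
    countWhere p (w.map f) = countWhere (fun x => p (f x)) w := by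
  rw [countWhere, List.countP_map]
  rfl

theorem countWhere_congr {p q : α → Prop} {w : List α} (h : ∀ x ∈ w, (p x ↔ q x)) :
    countWhere p w = countWhere q w :=
  List.countP_congr fun x hx => by simp [h x hx]

end countWhere

theorem countWhere_graftAux (s : PlanarTree) (l : List PlanarTree) (Q : Multiset RTree → Prop) :
    countWhere (fun x => Q (classes x)) (graftAux s l) =
      ((l : Multiset PlanarTree).map fun Y => countWhere
        (fun X => Q (RTree.mk X ::ₘ (classes l).erase (RTree.mk Y))) (graftList s Y)).sum := by
  induction l generalizing Q with
  | nil => simp [graftAux]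
  | cons a l ih =>
    rw [graftAux, countWhere_append, countWhere_map, countWhere_map, ← Multiset.cons_coe,
      Multiset.map_cons, Multiset.sum_cons]
    congr 1
    · simp
    · simp only [classes_cons]
      rw [ih fun M => Q (RTree.mk a ::ₘ M)]
      congr 1
      refine Multiset.map_congr rfl fun Y hY => ?_
      rw [Multiset.erase_cons_tail_of_mem (mk_mem_classes (Multiset.mem_coe.1 hY))]
      simp only [Multiset.cons_swap]

theorem countWhere_cutAux (l : List PlanarTree) (Q : PlanarTree → Multiset RTree → Prop) :
    countWhere (fun x => Q x.1 (classes x.2)) (cutAux l) =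
      countWhere (fun X => Q X ((classes l).erase (RTree.mk X))) l +
      ((l : Multiset PlanarTree).map fun X => countWhere
        (fun x => Q x.1 (RTree.mk x.2 ::ₘ (classes l).erase (RTree.mk X))) (cutPairs X)).sum := by
  induction l generalizing Q with
  | nil => simp [cutAux]
  | cons a l ih =>
    have h1 : countWhere (fun X => Q X ((classes (a :: l)).erase (RTree.mk X))) l =
        countWhere (fun X => Q X (RTree.mk a ::ₘ (classes l).erase (RTree.mk X))) l := by
      refine countWhere_congr fun X hX => ?_
      rw [classes_cons, Multiset.erase_cons_tail_of_mem (mk_mem_classes hX)]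
    have h2 : ((l : Multiset PlanarTree).map fun X => countWhere
        (fun x => Q x.1 (RTree.mk x.2 ::ₘ (classes (a :: l)).erase (RTree.mk X))) (cutPairs X)).sum =
        ((l : Multiset PlanarTree).map fun X => countWhere
        (fun x => Q x.1 (RTree.mk a ::ₘ RTree.mk x.2 ::ₘ (classes l).erase (RTree.mk X))) (cutPairs X)).sum := by
      congr 1
      refine Multiset.map_congr rfl fun Y hY => ?_
      rw [classes_cons, Multiset.erase_cons_tail_of_mem (mk_mem_classes (Multiset.mem_coe.1 hY))]
      simp only [Multiset.cons_swap]
    rw [cutAux, countWhere_cons, countWhere_append, countWhere_map, countWhere_map,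
      ← Multiset.cons_coe, Multiset.map_cons, Multiset.sum_cons,
      countWhere_cons, h1, h2]
    simp only [classes_cons, Multiset.erase_cons_head]
    rw [ih fun X M => Q X (RTree.mk a ::ₘ M)]
    ring

theorem ite_cons_eq_sum (T : RTree) (N : Multiset RTree) (l : List PlanarTree) :
    (if T ::ₘ N = classes l then (1 : ℚ) else 0) =
      ((l : Multiset PlanarTree).map fun Y =>
        if N = (classes l).erase (RTree.mk Y) then
          (if T = RTree.mk Y then (1 : ℚ) else 0) / (classes l).count (RTree.mk Y) else 0).sum := by
  have h : ((l : Multiset PlanarTree).map fun Y =>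
        if N = (classes l).erase (RTree.mk Y) then
          (if T = RTree.mk Y then (1 : ℚ) else 0) / (classes l).count (RTree.mk Y) else 0) =
      (classes l).map fun Y => if N = (classes l).erase Y then
          (if T = Y then (1 : ℚ) else 0) / (classes l).count Y else 0 := by
    conv_rhs => rw [classes, Multiset.map_map]
    rfl
  rw [h]
  generalize classes l = L
  rw [Finset.sum_multiset_map_count, Finset.sum_eq_single T]
  · by_cases hT : T ∈ L
    · have hc : (L.count T : ℚ) ≠ 0 := by
        exact_mod_cast (Multiset.count_pos.2 hT).ne'
      have : T ::ₘ N = L ↔ N = L.erase T := by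
        conv_lhs => rw [← Multiset.cons_erase hT, Multiset.cons_inj_right]
      simp only [this, if_true, nsmul_eq_mul]
      split_ifs
      · field_simp
      · simp
    · rw [if_neg, Multiset.count_eq_zero_of_notMem hT, zero_nsmul]
      rintro rfl
      exact hT (Multiset.mem_cons_self _ _)
  · intro Y _ hY
    simp [hY.symm]
  · intro hT
    rw [Multiset.mem_toFinset] at hT
    rw [Multiset.count_eq_zero_of_notMem hT, zero_nsmul]

theorem countWhere_cons_eq_sum {α : Type*} (p : α → Prop) (g : α → RTree) (w : List α)
    (N : Multiset RTree) (l : List PlanarTree) :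
    ((countWhere (fun x => p x ∧ g x ::ₘ N = classes l) w : ℕ) : ℚ) =
      ((l : Multiset PlanarTree).map fun Y =>
        if N = (classes l).erase (RTree.mk Y) then
          ((countWhere (fun x => p x ∧ g x = RTree.mk Y) w : ℕ) : ℚ) /
            (classes l).count (RTree.mk Y) else 0).sum := by
  induction w with
  | nil => simp
  | cons x w ih =>
    simp only [countWhere_cons, Nat.cast_add, ih, add_div]
    have key : ((if p x ∧ g x ::ₘ N = classes l then 1 else 0 : ℕ) : ℚ) =
        ((l : Multiset PlanarTree).map fun Y =>
        if N = (classes l).erase (RTree.mk Y) then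
          ((if p x ∧ g x = RTree.mk Y then 1 else 0 : ℕ) : ℚ) /
            (classes l).count (RTree.mk Y) else 0).sum := by
      by_cases hp : p x
      · simpa [hp] using ite_cons_eq_sum (g x) N l
      · simp [hp]
    rw [key, ← Multiset.sum_map_add]
    congr 1
    refine Multiset.map_congr rfl fun Y _ => ?_
    split_ifs <;> simp

theorem count_classes (T : RTree) (l : List PlanarTree) :
    (classes l).count T = countWhere (fun X => RTree.mk X = T) l := by
  induction l with
  | nil => rfl
  | cons a l ih => simp only [classes_cons, Multiset.count_cons, countWhere_cons, ih, eq_comm]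

theorem sg_mul_countWhere_branch (a : PlanarTree) (k l : List PlanarTree) :
    a.sg * branchSg (classes l) * countWhere
        (fun X => RTree.mk X = RTree.mk a ∧ (classes k).erase (RTree.mk X) = classes l) k =
      (if RTree.mk a ::ₘ classes l = classes k then 1 else 0) * branchSg (classes k) := by
  split_ifs with h
  · rw [countWhere_congr (q := fun X => RTree.mk X = RTree.mk a), ← count_classes, ← h,
      branchSg_cons, Multiset.count_cons_self, RTree.sg_mk]
    · ring
    · intro X _
      rw [and_iff_left_iff_imp]
      intro hX
      rw [hX, ← h, Multiset.erase_cons_head]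
  · rw [countWhere_congr (q := fun _ => False)]
    · simp [countWhere]
    · intro X hX
      rw [iff_false]
      rintro ⟨hXa, hL⟩
      rw [← hL, ← hXa, Multiset.cons_erase (mk_mem_classes hX)] at h
      exact h rfl

theorem sg_mul_sum_cutPairs (a : PlanarTree) (k l : List PlanarTree)
    (ih : ∀ X ∈ k, ∀ b : PlanarTree, a.sg * b.sg * countWhere
        (fun x => RTree.mk x.1 = RTree.mk a ∧ RTree.mk x.2 = RTree.mk b) X.cutPairs =
      countWhere (fun x => RTree.mk x = RTree.mk X) (graftList a b) * X.sg) :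
    a.sg * branchSg (classes l) *
        ((k : Multiset PlanarTree).map fun X => countWhere
          (fun x => RTree.mk x.1 = RTree.mk a ∧
            RTree.mk x.2 ::ₘ (classes k).erase (RTree.mk X) = classes l) X.cutPairs).sum =
      ((l : Multiset PlanarTree).map fun Y => countWhere
          (fun X => RTree.mk X ::ₘ (classes l).erase (RTree.mk Y) = classes k) (graftList a Y)).sum *
        branchSg (classes k) := by
  have hgraft (Y : PlanarTree) := countWhere_cons_eq_sum (fun _ => True) RTree.mk (graftList a Y)
    ((classes l).erase (RTree.mk Y)) k
  have hcut (X : PlanarTree) := countWhere_cons_eq_sum (fun x => RTree.mk x.1 = RTree.mk a)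
    (fun x => RTree.mk x.2) X.cutPairs ((classes k).erase (RTree.mk X)) l
  simp only [true_and] at hgraft
  rw [← @Nat.cast_inj ℚ]
  simp only [Nat.cast_mul, Nat.cast_multiset_sum, Multiset.map_map, Function.comp_def]
  simp only [hgraft, hcut]
  rw [Multiset.sum_map_sum_map, ← Multiset.sum_map_mul_left, ← Multiset.sum_map_mul_right]
  congr 1
  refine Multiset.map_congr rfl fun Y hY => ?_
  rw [← Multiset.sum_map_mul_left, ← Multiset.sum_map_mul_right]
  congr 1
  refine Multiset.map_congr rfl fun X hX => ?_
  rw [Multiset.mem_coe] at hX hY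
  simp only [eq_comm (a := (classes l).erase (RTree.mk Y))]
  split_ifs with h
  · have hl := RTree.branchSg_eq (mk_mem_classes hY)
    have hk := RTree.branchSg_eq (mk_mem_classes hX)
    have hcl : ((classes l).count (RTree.mk Y) : ℚ) ≠ 0 := by
      exact_mod_cast (Multiset.count_pos.2 (mk_mem_classes hY)).ne'
    have hck : ((classes k).count (RTree.mk X) : ℚ) ≠ 0 := by
      exact_mod_cast (Multiset.count_pos.2 (mk_mem_classes hX)).ne'
    have hXY := ih X hX Y
    rw [RTree.sg_mk] at hl hk
    qify at hXY
    rw [hl, hk, h]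
    push_cast
    field_simp
    linear_combination (branchSg ((classes l).erase (RTree.mk Y)) : ℚ) * hXY
  · simp

/-- The reciprocity between grafting and cutting, for planar representatives. -/
theorem sg_mul_countWhere_cutPairs (a b c : PlanarTree) :
    a.sg * b.sg * countWhere
        (fun x => RTree.mk x.1 = RTree.mk a ∧ RTree.mk x.2 = RTree.mk b) c.cutPairs =
      countWhere (fun x => RTree.mk x = RTree.mk c) (graftList a b) * c.sg := by
  induction c using induction_on_branches generalizing b with
  | node k ih =>
  obtain ⟨l⟩ := b
  have hcut := countWhere_cutAux k fun X M => RTree.mk X = RTree.mk a ∧ M = classes l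
  have hgraft := countWhere_graftAux a l fun M => M = classes k
  have hbranch := sg_mul_countWhere_branch a k l
  have hdeep := sg_mul_sum_cutPairs a k l ih
  rw [cutPairs, graftList, countWhere_map, countWhere_cons, countWhere_map]
  simp only [mk_node_eq_iff, classes_cons]
  rw [hcut, hgraft, RTree.sg_node_eq_branchSg, RTree.sg_node_eq_branchSg, mul_add, hbranch, hdeep]
  ring

end PlanarTree

/-- For rooted trees with `|t₁| + |t₂| = |t₃|`,
`|SG(t₁)|·|SG(t₂)|·m(t₁,t₂;t₃) = n(t₁,t₂;t₃)·|SG(t₃)|`. -/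
theorem stmt19 (t₁ t₂ t₃ : RTree) (h : t₁.size + t₂.size = t₃.size) :
    t₁.sg * t₂.sg * RTree.mTri t₁ t₂ t₃ = RTree.nTri t₁ t₂ t₃ * t₃.sg := by
  have key := PlanarTree.sg_mul_countWhere_cutPairs t₁.rep t₂.rep t₃.rep
  simp only [RTree.mk_rep, PlanarTree.countWhere] at key
  unfold RTree.sg RTree.mTri RTree.nTri
  convert key
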